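/- (Łojasiewicz inequality, compact form) Let f be a real analytic real-valued function on an open set V ⊆ ℝ^d, and let Z_f = {x ∈ V : f(x) = 0}. Then for every compact set K ⊆ V there exist constants c > 0 and m > 0 such that |f(x)| ≥ c · dist(x, Z_f)^m for all x ∈ K. -/

import Mathlib

open Metric

open Metric Filter Topology
open scoped BoundedContinuousFunction NNReal ENNReal

theorem loj_cos_bound {E : Type*} [NormedAddCommGroup E] [NormedSpace ℝ E]
    (p : FormalMultilinearSeries ℝ E ℝ) (r C : ℝ) (hr : 0 < r) (hC : 0 ≤ C)
    (hp : ∀ n, ‖p n‖ ≤ C / r ^ n) (w : E) (hw : ‖w‖ ≤ r / 2) (k j : ℕ) (v : Fin j → E) :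
    ‖p.changeOriginSeries k j v (fun _ => w)‖ ≤ (C * (2 / r) ^ j) * ∏ i, ‖v i‖ := by
  have h1 : ‖p.changeOriginSeries k j‖ ≤ 2 ^ (k + j) * (C / r ^ (k + j)) := by
    have h2 : ‖p.changeOriginSeries k j‖ ≤
        ∑ s : { s : Finset (Fin (k + j)) // s.card = j }, ‖p (k + j)‖ := by
      have h0 := norm_sum_le (Finset.univ : Finset { s : Finset (Fin (k + j)) // s.card = j })
        (fun s => p.changeOriginSeriesTerm k j s s.2)
      refine h0.trans_eq ?_
      exact Finset.sum_congr rfl fun s _ => p.norm_changeOriginSeriesTerm k j s s.2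
    refine h2.trans ?_
    rw [Finset.sum_const, nsmul_eq_mul]
    refine mul_le_mul ?_ (hp _) (norm_nonneg _) (by positivity)
    have h3 : Fintype.card { s : Finset (Fin (k + j)) // s.card = j } ≤ 2 ^ (k + j) := by
      refine (Fintype.card_subtype_le _).trans ?_
      simp
    exact_mod_cast h3
  have h4 : ‖p.changeOriginSeries k j v (fun _ => w)‖ ≤
      ‖p.changeOriginSeries k j‖ * (∏ i, ‖v i‖) * ‖w‖ ^ k := by
    refine (ContinuousMultilinearMap.le_opNorm _ _).trans ?_
    rw [Fin.prod_const]
    gcongr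
    exact ContinuousMultilinearMap.le_opNorm _ _
  refine h4.trans ?_
  have h5 : 0 ≤ ∏ i, ‖v i‖ := Finset.prod_nonneg fun _ _ => norm_nonneg _
  calc ‖p.changeOriginSeries k j‖ * (∏ i, ‖v i‖) * ‖w‖ ^ k
      ≤ (2 ^ (k + j) * (C / r ^ (k + j))) * (∏ i, ‖v i‖) * (r / 2) ^ k := by gcongr
    _ = _ := by
      rw [pow_add, pow_add, div_pow, div_pow]
      field_simp

/-- The series of the map `v ↦ (coefficients of t ↦ f (v + t w))`. -/
noncomputable def lojSeries {E : Type*} [NormedAddCommGroup E] [NormedSpace ℝ E]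
    (p : FormalMultilinearSeries ℝ E ℝ) (r C : ℝ) (hr : 0 < r) (hC : 0 ≤ C)
    (hp : ∀ n, ‖p n‖ ≤ C / r ^ n) (w : E) (hw : ‖w‖ ≤ r / 2) :
    FormalMultilinearSeries ℝ E (ℕ →ᵇ ℝ) := fun j =>
  MultilinearMap.mkContinuous
    { toFun := fun v => BoundedContinuousFunction.ofNormedAddCommGroupDiscrete
        (fun k => p.changeOriginSeries k j v (fun _ => w)) ((C * (2 / r) ^ j) * ∏ i, ‖v i‖)
        (fun k => loj_cos_bound p r C hr hC hp w hw k j v)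
      map_update_add' := by
        intro _ m i x y
        ext k
        simp
      map_update_smul' := by
        intro _ m i c x
        ext k
        simp }
    (C * (2 / r) ^ j)
    (by
      intro v
      refine (BoundedContinuousFunction.norm_le (by positivity)).2 fun k => ?_
      exact loj_cos_bound p r C hr hC hp w hw k j v)

theorem loj_fiber {E : Type*} [NormedAddCommGroup E] [NormedSpace ℝ E]
    (f : E → ℝ) (hf : AnalyticAt ℝ f 0) :
    ∃ R : ℝ, 0 < R ∧ ∀ w : E, ‖w‖ ≤ R → ∃ F : E → (ℕ →ᵇ ℝ), AnalyticAt ℝ F 0 ∧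
      ∀ᶠ v in 𝓝 (0 : E), ∀ t : ℝ, |t| ≤ 1 → HasSum (fun k => F v k * t ^ k) (f (v + t • w)) := by
  obtain ⟨p, r0, hp0⟩ := hf
  obtain ⟨r, hr, hrr⟩ := ENNReal.lt_iff_exists_nnreal_btwn.1 hp0.r_pos
  have hr' : 0 < r := by exact_mod_cast hr
  obtain ⟨C, hC, hC'⟩ := p.norm_le_div_pow_of_pos_of_lt_radius hr' (hrr.trans_le hp0.r_le)
  have hr2 : (0 : ℝ) < r := by exact_mod_cast hr'
  refine ⟨r / 4, by positivity, fun w hw => ?_⟩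
  have hw2 : ‖w‖ ≤ r / 2 := by linarith
  set P := lojSeries p r C hr2 hC.le hC' w hw2 with hP
  have hPn : ∀ j, ‖P j‖ ≤ C * (2 / r) ^ j := fun j =>
    MultilinearMap.mkContinuous_norm_le _ (by positivity) _
  have hrad : ((r / 2 : ℝ≥0) : ℝ≥0∞) ≤ P.radius := by
    refine P.le_radius_of_bound C fun n => ?_
    calc ‖P n‖ * ((r / 2 : ℝ≥0) : ℝ) ^ n ≤ C * (2 / r) ^ n * ((r / 2 : ℝ≥0) : ℝ) ^ n := by
          gcongr; exact hPn n
      _ = C := by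
        push_cast
        rw [mul_assoc, ← mul_pow]
        field_simp
        simp
  have hradpos : 0 < P.radius := lt_of_lt_of_le (by exact_mod_cast (by positivity)) hrad
  have hS := P.hasFPowerSeriesOnBall hradpos
  refine ⟨P.sum, hS.analyticAt, ?_⟩
  have hball : Metric.ball (0 : E) (r / 4) ∈ 𝓝 (0 : E) := Metric.ball_mem_nhds _ (by positivity)
  filter_upwards [hball] with v hv t ht
  have hv' : ‖v‖ < r / 4 := by simpa using hv
  have hvr : ‖v‖ₑ < r0 := by
    refine lt_trans ?_ hrr
    rw [← ofReal_norm, ← ENNReal.ofReal_coe_nnreal]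
    exact (ENNReal.ofReal_lt_ofReal_iff hr2).2 (by linarith)
  have hcoef : ∀ k, P.sum v k = p.changeOrigin v k (fun _ => w) := by
    intro k
    have h1 : HasSum (fun j => P j (fun _ => v)) (P.sum v) := by
      refine P.hasSum ?_
      rw [Metric.mem_eball, edist_zero_right]
      refine lt_of_lt_of_le ?_ hrad
      rw [← ofReal_norm, ← ENNReal.ofReal_coe_nnreal]
      refine (ENNReal.ofReal_lt_ofReal_iff (by positivity)).2 ?_
      push_cast; linarith
    have h2 := (BoundedContinuousFunction.evalCLM ℝ k).hasSum h1
    have h3 : HasSum (fun j => p.changeOriginSeries k j (fun _ => v)) (p.changeOrigin v k) := by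
      have := (p.hasFPowerSeriesOnBall_changeOrigin k (hp0.r_pos.trans_le hp0.r_le)).hasSum
        (y := v) (by rw [Metric.mem_eball, edist_zero_right]; exact hvr.trans_le hp0.r_le)
      simpa using this
    have h4 := ContinuousMultilinearMap.hasSum_eval h3 (fun _ => w)
    exact h2.unique h4
  have h5 := (hp0.changeOrigin hvr).hasSum (y := t • w) (by
    rw [Metric.mem_eball, edist_zero_right, lt_tsub_iff_right]
    refine lt_trans ?_ hrr
    change ‖t • w‖ₑ + ‖v‖ₑ < _
    rw [← ofReal_norm, ← ofReal_norm, ← ENNReal.ofReal_coe_nnreal,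
      ← ENNReal.ofReal_add (norm_nonneg _) (norm_nonneg _)]
    refine (ENNReal.ofReal_lt_ofReal_iff (by positivity)).2 ?_
    rw [norm_smul, Real.norm_eq_abs]
    have : |t| * ‖w‖ ≤ 1 * (r / 4) := by gcongr
    linarith)
  rw [zero_add] at h5
  have h6 : (fun k => P.sum v k * t ^ k) = fun n => (p.changeOrigin v n) fun _ => t • w := by
    funext k
    rw [hcoef, ContinuousMultilinearMap.map_smul_univ]
    simp [mul_comm]
  rw [h6]
  exact h5

/-- Multiplication by `t ^ n` on coefficient sequences. -/
noncomputable def lojShift (n : ℕ) : (ℕ →ᵇ ℝ) →L[ℝ] (ℕ →ᵇ ℝ) :=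
  LinearMap.mkContinuous
    { toFun := fun u => BoundedContinuousFunction.ofNormedAddCommGroupDiscrete
        (fun k => if k < n then 0 else u (k - n)) ‖u‖ (by
          intro k
          split_ifs
          · simp
          · exact u.norm_coe_le_norm _)
      map_add' := by
        intro u v; ext k; simp only [BoundedContinuousFunction.coe_add, Pi.add_apply,
          BoundedContinuousFunction.coe_ofNormedAddCommGroupDiscrete]
        split_ifs <;> simp
      map_smul' := by
        intro c u; ext k; simp }
    1 (by
      intro u
      rw [one_mul]
      refine (BoundedContinuousFunction.norm_le (norm_nonneg _)).2 fun k => ?_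
      simp only [LinearMap.coe_mk, AddHom.coe_mk,
          BoundedContinuousFunction.coe_ofNormedAddCommGroupDiscrete]
      split_ifs
      · simp
      · exact u.norm_coe_le_norm _)

theorem lojShift_apply (n : ℕ) (u : ℕ →ᵇ ℝ) (k : ℕ) :
    lojShift n u k = if k < n then 0 else u (k - n) := rfl

/-- Backward shift. -/
noncomputable def lojBack (n : ℕ) (u : ℕ →ᵇ ℝ) : ℕ →ᵇ ℝ :=
  BoundedContinuousFunction.ofNormedAddCommGroupDiscrete
    (fun k => u (k + n)) ‖u‖ (fun _ => u.norm_coe_le_norm _)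

theorem lojBack_apply (n : ℕ) (u : ℕ →ᵇ ℝ) (k : ℕ) : lojBack n u k = u (k + n) := rfl

theorem lojShift_back (n : ℕ) (u : ℕ →ᵇ ℝ) (h : ∀ k < n, u k = 0) :
    lojShift n (lojBack n u) = u := by
  ext k
  rw [lojShift_apply]
  split_ifs with hk
  · exact (h k hk).symm
  · rw [lojBack_apply]; congr 1; omega

/-- Evaluation of the power series. -/
noncomputable def lojEv (u : ℕ →ᵇ ℝ) (t : ℝ) : ℝ := ∑' k, u k * t ^ k

theorem lojEv_hasSum (u : ℕ →ᵇ ℝ) {t : ℝ} (ht : |t| < 1) :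
    HasSum (fun k => u k * t ^ k) (lojEv u t) := by
  refine Summable.hasSum (Summable.of_norm_bounded (g := fun k => ‖u‖ * |t| ^ k) ?_ ?_)
  · exact (summable_geometric_of_lt_one (abs_nonneg _) ht).mul_left _
  · intro k
    rw [norm_mul, norm_pow, Real.norm_eq_abs t]
    gcongr
    exact u.norm_coe_le_norm _

theorem lojEv_shift (n : ℕ) (u : ℕ →ᵇ ℝ) {t : ℝ} (ht : |t| < 1) :
    HasSum (fun k => lojShift n u k * t ^ k) (t ^ n * lojEv u t) := by
  have h := (lojEv_hasSum u ht).mul_left (t ^ n)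
  have h2 : HasSum (fun k => lojShift n u (k + n) * t ^ (k + n)) (t ^ n * lojEv u t) := by
    refine h.congr_fun ?_
    intro k
    rw [lojShift_apply, if_neg (by omega), Nat.add_sub_cancel, pow_add]
    ring
  have h3 := (hasSum_nat_add_iff (f := fun k => lojShift n u k * t ^ k) n).1 h2
  rw [Finset.sum_eq_zero, add_zero] at h3
  · exact h3
  · intro i hi
    rw [lojShift_apply, if_pos (Finset.mem_range.1 hi), zero_mul]

theorem lojEv_bound (u : ℕ →ᵇ ℝ) {t : ℝ} (ht : |t| ≤ 1 / 2) : |lojEv u t - u 0| ≤ 2 * ‖u‖ * |t| := by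
  have ht1 : |t| < 1 := by linarith
  have h := lojEv_hasSum u ht1
  have h2 := (hasSum_nat_add_iff' (f := fun k => u k * t ^ k) 1).2 h
  simp only [Finset.sum_range_one, pow_zero, mul_one] at h2
  have h3 : HasSum (fun k : ℕ => ‖u‖ * |t| * (1 / 2 : ℝ) ^ k) (‖u‖ * |t| * 2) :=
    hasSum_geometric_two.mul_left _
  have h4 := h2.norm_le_of_bounded h3 (fun k => by
    rw [norm_mul, norm_pow, Real.norm_eq_abs t, pow_succ, mul_assoc, mul_comm |t|]
    gcongr
    exact u.norm_coe_le_norm _)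
  rw [Real.norm_eq_abs] at h4
  linarith

theorem loj_prep_local (p : ℕ) (F0 : ℕ →ᵇ ℝ) (h0 : ∀ k < p, F0 k = 0) (hp : F0 p ≠ 0) :
    ∃ (A : (ℕ →ᵇ ℝ) → (Fin p → ℝ)) (U : (ℕ →ᵇ ℝ) → (ℕ →ᵇ ℝ)),
      AnalyticAt ℝ A F0 ∧ ContinuousAt U F0 ∧ A F0 = 0 ∧ U F0 0 ≠ 0 ∧
      ∀ᶠ b in 𝓝 F0, b = lojShift p (U b) + ∑ i, A b i • lojShift i (U b) := by
  set u0 := lojBack p F0 with hu0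
  have hu00 : u0 0 ≠ 0 := by rw [hu0, lojBack_apply, zero_add]; exact hp
  have hsb : lojShift p u0 = F0 := lojShift_back p F0 h0
  let Ψ : (Fin p → ℝ) × (ℕ →ᵇ ℝ) → (ℕ →ᵇ ℝ) :=
    fun x => lojShift p x.2 + ∑ i, x.1 i • lojShift i x.2
  have hΨ : ContDiff ℝ ⊤ Ψ := by
    have hS : ∀ n, ContDiff ℝ ⊤ (fun x : (Fin p → ℝ) × (ℕ →ᵇ ℝ) => lojShift n x.2) :=
      fun n => (lojShift n).contDiff.comp contDiff_snd
    have hA : ∀ i, ContDiff ℝ ⊤ (fun x : (Fin p → ℝ) × (ℕ →ᵇ ℝ) => x.1 i) := fun i =>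
      (ContinuousLinearMap.proj (R := ℝ) (φ := fun _ : Fin p => ℝ) i).contDiff.comp contDiff_fst
    have hT : ContDiff ℝ ⊤ (fun x : (Fin p → ℝ) × (ℕ →ᵇ ℝ) => ∑ i, x.1 i • lojShift i x.2) :=
      ContDiff.sum fun i _ => (hA i).smul (hS i)
    exact (hS p).add hT
  let D : (Fin p → ℝ) × (ℕ →ᵇ ℝ) →L[ℝ] (ℕ →ᵇ ℝ) :=
    (lojShift p).comp (ContinuousLinearMap.snd ℝ _ _) +
      ∑ i, ((ContinuousLinearMap.proj (R := ℝ) (φ := fun _ : Fin p => ℝ) i).comp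
        (ContinuousLinearMap.fst ℝ _ _)).smulRight (lojShift i u0)
  have hDa : ∀ x, D x = lojShift p x.2 + ∑ i, x.1 i • lojShift i u0 := by
    intro x
    simp [D]
  have hD : HasFDerivAt Ψ D (0, u0) := by
    have h1 : HasFDerivAt (fun x : (Fin p → ℝ) × (ℕ →ᵇ ℝ) => lojShift p x.2)
        ((lojShift p).comp (ContinuousLinearMap.snd ℝ _ _)) (0, u0) :=
      (lojShift p).hasFDerivAt.comp _ hasFDerivAt_snd
    refine h1.add (HasFDerivAt.fun_sum fun i _ => ?_)
    have h2 : HasFDerivAt (fun x : (Fin p → ℝ) × (ℕ →ᵇ ℝ) => lojShift i x.2)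
        ((lojShift i).comp (ContinuousLinearMap.snd ℝ _ _)) (0, u0) :=
      (lojShift i).hasFDerivAt.comp _ hasFDerivAt_snd
    have h3 : HasFDerivAt (fun x : (Fin p → ℝ) × (ℕ →ᵇ ℝ) => x.1 i)
        ((ContinuousLinearMap.proj (R := ℝ) (φ := fun _ : Fin p => ℝ) i).comp
        (ContinuousLinearMap.fst ℝ _ _)) (0, u0) :=
      (ContinuousLinearMap.proj (R := ℝ) (φ := fun _ : Fin p => ℝ) i).hasFDerivAt.comp _
        hasFDerivAt_fst
    have h4 := h3.smul h2
    simpa using! h4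
  let M : (Fin p → ℝ) →ₗ[ℝ] (Fin p → ℝ) :=
    { toFun := fun a i => ∑ j, a j * lojShift j u0 i
      map_add' := by intro a b; ext i; simp [add_mul, Finset.sum_add_distrib]
      map_smul' := by intro c b; ext i; simp [Finset.mul_sum, mul_assoc] }
  have hMa : ∀ a i, M a i = ∑ j, a j * lojShift j u0 i := fun _ _ => rfl
  have hMi : Function.Injective M := by
    rw [← LinearMap.ker_eq_bot, LinearMap.ker_eq_bot']
    intro a ha
    have key : ∀ n : ℕ, ∀ hn : n < p, a ⟨n, hn⟩ = 0 := by
      intro n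
      induction n using Nat.strong_induction_on with
      | _ n ih =>
        intro hn
        have h1 := congrFun ha ⟨n, hn⟩
        rw [hMa, Finset.sum_eq_single ⟨n, hn⟩] at h1
        · rw [lojShift_apply] at h1
          simpa [hu00] using h1
        · intro j _ hj
          have hj' : (j : ℕ) ≠ n := fun h => hj (Fin.ext h)
          rcases lt_or_gt_of_ne hj' with h | h
          · rw [ih j h j.2, zero_mul]
          · rw [lojShift_apply, if_pos h, mul_zero]
        · simp
    ext i
    exact key i i.2
  have hMs : Function.Surjective M := LinearMap.injective_iff_surjective.1 hMi
  have hcoef : ∀ (a : Fin p → ℝ) (i : Fin p), (∑ j, a j • lojShift j u0) (i : ℕ) = M a i := by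
    intro a i
    rw [hMa, BoundedContinuousFunction.sum_apply]
    simp
  have hinj : D.ker = ⊥ := by
    rw [LinearMap.ker_eq_bot']
    rintro ⟨a, u⟩ h
    replace h : lojShift p u + ∑ i, a i • lojShift i u0 = 0 := by rw [← h]; exact (hDa (a, u)).symm
    have ha : a = 0 := by
      apply hMi
      rw [map_zero]
      ext i
      have h1 := DFunLike.congr_fun h (i : ℕ)
      rw [BoundedContinuousFunction.add_apply, hcoef, lojShift_apply, if_pos i.2, zero_add] at h1
      exact h1
    subst ha
    have hu : u = 0 := by
      ext k
      have h1 := DFunLike.congr_fun h (k + p)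
      simp only [Pi.zero_apply, zero_smul, Finset.sum_const_zero, add_zero] at h1
      rw [lojShift_apply, if_neg (by omega), Nat.add_sub_cancel] at h1
      exact h1
    rw [hu]; rfl
  have hsurj : D.range = ⊤ := by
    rw [LinearMap.range_eq_top]
    intro c
    obtain ⟨a, ha⟩ := hMs (fun i => c i)
    refine ⟨(a, lojBack p (c - ∑ j, a j • lojShift j u0)), ?_⟩
    refine (hDa _).trans ?_
    simp only
    rw [lojShift_back]
    · abel
    · intro k hk
      have h1 := hcoef a ⟨k, hk⟩
      rw [ha] at h1
      simp only at h1
      rw [BoundedContinuousFunction.sub_apply, h1, sub_self]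
  let e := ContinuousLinearEquiv.ofBijective D hinj hsurj
  have hD' : HasFDerivAt Ψ (e : (Fin p → ℝ) × (ℕ →ᵇ ℝ) →L[ℝ] (ℕ →ᵇ ℝ)) (0, u0) := by
    rw [ContinuousLinearEquiv.coe_ofBijective]; exact hD
  have hc : ContDiffAt ℝ ⊤ Ψ (0, u0) := hΨ.contDiffAt
  have hΨ0 : Ψ (0, u0) = F0 := by simp [Ψ, hsb]
  have hinv := hc.to_localInverse hD' (by simp)
  have hinv0 := hc.localInverse_apply_image hD' (by simp)
  have hr := (hc.hasStrictFDerivAt' hD' (by simp)).eventually_right_inverse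
  rw [hΨ0] at hinv hinv0 hr
  set G := hc.localInverse hD' (by simp) with hG
  have hGa : AnalyticAt ℝ G F0 := hinv.analyticAt
  refine ⟨fun b => (G b).1, fun b => (G b).2, ?_, ?_, ?_, ?_, ?_⟩
  · exact analyticAt_fst.comp hGa
  · exact continuousAt_snd.comp hGa.continuousAt
  · simp [hinv0]
  · simpa [hinv0] using hu00
  · filter_upwards [hr] with b hb
    exact hb.symm

theorem loj_weier {E : Type*} [NormedAddCommGroup E] [NormedSpace ℝ E] (g : E × ℝ → ℝ)
    (hg : AnalyticAt ℝ g 0) (h0 : g 0 = 0) (hn : ¬ ∀ᶠ t in 𝓝 (0 : ℝ), g (0, t) = 0) :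
    ∃ (ρ : ℝ) (p : ℕ) (a : E → Fin p → ℝ) (c : ℝ) (U : E × ℝ → ℝ),
      0 < ρ ∧ 1 ≤ p ∧ 0 < c ∧ AnalyticAt ℝ a 0 ∧ a 0 = 0 ∧
      ∀ᶠ z in 𝓝 (0 : E × ℝ),
        g (z.1, ρ * z.2) = (z.2 ^ p + ∑ i, a z.1 i * z.2 ^ (i : ℕ)) * U z ∧ c ≤ |U z| := by
  obtain ⟨ρ, hρ, hw⟩ := loj_fiber g hg
  obtain ⟨F, hF, hFs⟩ := hw (0, ρ) (by simp [Prod.norm_def, abs_of_pos hρ, hρ.le])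
  have hF0 := hFs.self_of_nhds
  have hne : ∃ k, F 0 k ≠ 0 := by
    by_contra hcon
    push Not at hcon
    apply hn
    have : Metric.ball (0 : ℝ) ρ ∈ 𝓝 (0 : ℝ) := Metric.ball_mem_nhds _ hρ
    filter_upwards [this] with s hs
    have hs' : |s| < ρ := by simpa using hs
    have h1 := hF0 (s / ρ) (by rw [abs_div, abs_of_pos hρ, div_le_one hρ]; exact hs'.le)
    simp only [hcon, zero_mul] at h1
    have h2 := h1.unique hasSum_zero
    rw [← h2]
    congr 1
    ext <;> simp
    field_simp
  classical
  set p := Nat.find hne with hp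
  have hp0 : F 0 p ≠ 0 := Nat.find_spec hne
  have hpl : ∀ k < p, F 0 k = 0 := fun k hk => not_not.1 (Nat.find_min hne hk)
  have hp1 : 1 ≤ p := by
    by_contra hcon
    have hpz : p = 0 := by omega
    apply hp0
    rw [hpz]
    have h1 := hF0 0 (by simp)
    have h2 : HasSum (fun k => F 0 k * (0 : ℝ) ^ k) (F 0 0 * (0 : ℝ) ^ 0) := by
      refine hasSum_single 0 fun k hk => ?_
      simp [hk]
    have h3 := h1.unique h2
    simpa [h0] using h3.symm
  obtain ⟨A, W, hA, hW, hA0, hW0, hAW⟩ := loj_prep_local p (F 0) hpl hp0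
  have hι : AnalyticAt ℝ (fun x : E => ((x, 0) : E × ℝ)) 0 :=
    analyticAt_id.prod analyticAt_const
  have hFι : AnalyticAt ℝ (fun x : E => F (x, 0)) 0 :=
    AnalyticAt.comp (g := F) (f := fun x : E => ((x, 0) : E × ℝ)) hF hι
  refine ⟨ρ, p, fun x => A (F (x, 0)), |W (F 0) 0| / 2, fun z => lojEv (W (F (z.1, 0))) z.2,
    hρ, hp1, by positivity, ?_, hA0, ?_⟩
  · exact AnalyticAt.comp (g := A) (f := fun x : E => F (x, 0)) hA hFι
  have hc1 : Tendsto (fun z : E × ℝ => F (z.1, 0)) (𝓝 0) (𝓝 (F 0)) := by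
    have h1 : Tendsto (fun z : E × ℝ => z.1) (𝓝 0) (𝓝 0) := continuous_fst.tendsto' _ _ rfl
    exact (hFι.continuousAt.tendsto).comp h1
  have hc2 : Tendsto (fun z : E × ℝ => ((z.1, 0) : E × ℝ)) (𝓝 0) (𝓝 0) :=
    Continuous.tendsto' (by fun_prop) _ _ rfl
  have hc3 : Tendsto (fun z : E × ℝ => W (F (z.1, 0))) (𝓝 0) (𝓝 (W (F 0))) := hW.tendsto.comp hc1
  have hc4 : Tendsto (fun z : E × ℝ => z.2) (𝓝 0) (𝓝 0) := continuous_snd.tendsto' _ _ rfl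
  have hc5 : Tendsto (fun z : E × ℝ => |W (F (z.1, 0)) 0| - 2 * ‖W (F (z.1, 0))‖ * |z.2|) (𝓝 0)
      (𝓝 (|W (F 0) 0| - 2 * ‖W (F 0)‖ * |0|)) := by
    refine Tendsto.sub ?_ ((hc3.norm.const_mul 2).mul hc4.abs)
    exact (((BoundedContinuousFunction.evalCLM ℝ 0).continuous.tendsto (W (F 0))).comp hc3).abs
  have hpos : 0 < |W (F 0) 0| := abs_pos.2 hW0
  have hc6 := hc5.eventually (lt_mem_nhds (a := |W (F 0) 0| / 2) (by rw [abs_zero, mul_zero]; linarith))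
  have hc7 := hc4.eventually (Metric.ball_mem_nhds (0 : ℝ) (by norm_num : (0 : ℝ) < 1 / 2))
  filter_upwards [hc6, hc7, hc1.eventually hAW, hc2.eventually hFs] with z h6 h7 h8 h9
  have ht : |z.2| < 1 / 2 := by simpa using h7
  have ht1 : |z.2| < 1 := by linarith
  constructor
  · have h10 := h9 z.2 ht1.le
    have h11 : HasSum (fun k => F (z.1, 0) k * z.2 ^ k)
        (z.2 ^ p * lojEv (W (F (z.1, 0))) z.2 +
          ∑ i, A (F (z.1, 0)) i * (z.2 ^ (i : ℕ) * lojEv (W (F (z.1, 0))) z.2)) := by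
      have h12 := (lojEv_shift p (W (F (z.1, 0))) ht1).add (hasSum_sum (s := Finset.univ)
        (fun (i : Fin p) _ => (lojEv_shift i (W (F (z.1, 0))) ht1).mul_left (A (F (z.1, 0)) i)))
      refine h12.congr_fun ?_
      intro k
      conv_lhs => rw [h8]
      simp [add_mul, Finset.sum_mul, mul_assoc]
    have h13 := h10.unique h11
    have h14 : ((z.1, 0) : E × ℝ) + z.2 • ((0, ρ) : E × ℝ) = (z.1, ρ * z.2) := by
      ext <;> simp [mul_comm]
    rw [h14] at h13
    rw [h13, add_mul, Finset.sum_mul]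
    congr 1
    exact Finset.sum_congr rfl fun i _ => by ring
  · have h15 := lojEv_bound (W (F (z.1, 0))) ht.le
    have h16 := abs_sub_abs_le_abs_sub (W (F (z.1, 0)) 0) (lojEv (W (F (z.1, 0))) z.2)
    rw [abs_sub_comm] at h16
    linarith

/-- Generalized discriminants of a family of complex numbers. -/
noncomputable def lojD {p : ℕ} (α : Fin p → ℂ) (k : ℕ) : ℂ :=
  ∑ I ∈ Finset.powersetCard k (Finset.univ : Finset (Fin p)), ∏ x ∈ I.offDiag, (α x.1 - α x.2)

theorem loj_vieta {p : ℕ} (a : Fin p → ℝ) (α : Fin p → ℂ)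
    (h : ∀ z : ℂ, z ^ p + ∑ i, (a i : ℂ) * z ^ (i : ℕ) = ∏ i, (z - α i)) (i : Fin p) :
    MvPolynomial.aeval α (MvPolynomial.esymm (Fin p) ℝ (i + 1)) =
      (-1) ^ ((i : ℕ) + 1) * (a (Fin.rev i) : ℂ) := by
  have h1 : (Polynomial.X ^ p + ∑ i : Fin p, Polynomial.C (a i : ℂ) * Polynomial.X ^ (i : ℕ) :
      Polynomial ℂ) = ((Finset.univ.val.map α).map fun r => Polynomial.X - Polynomial.C r).prod := by
    apply Polynomial.funext
    intro z
    rw [Multiset.map_map]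
    change _ = Polynomial.eval z (∏ i, (Polynomial.X - Polynomial.C (α i)))
    rw [Polynomial.eval_prod]
    simpa [Polynomial.eval_finsetSum] using h z
  have h2 := congrArg (fun q => Polynomial.coeff q (Fin.rev i : ℕ)) h1
  beta_reduce at h2
  rw [Multiset.prod_X_sub_C_coeff _ (by simp)] at h2
  rw [MvPolynomial.aeval_esymm_eq_multiset_esymm]
  have h3 : Multiset.card (Finset.univ.val.map α) - (Fin.rev i : ℕ) = i + 1 := by
    simp [Fin.val_rev]; omega
  rw [h3] at h2
  have h4 : (Fin.rev i : ℕ) ≠ p := by have := (Fin.rev i).2; omega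
  have h5 : (Polynomial.X ^ p + ∑ i : Fin p, Polynomial.C (a i : ℂ) * Polynomial.X ^ (i : ℕ) :
      Polynomial ℂ).coeff (Fin.rev i : ℕ) = a (Fin.rev i) := by
    rw [Polynomial.coeff_add, Polynomial.coeff_X_pow, if_neg h4, zero_add,
      Polynomial.finsetSum_coeff, Finset.sum_eq_single (Fin.rev i)]
    · simp
    · intro j _ hj
      rw [Polynomial.coeff_C_mul, Polynomial.coeff_X_pow, if_neg, mul_zero]
      exact fun h => hj (Fin.ext h.symm)
    · simp
  rw [h5] at h2
  rw [h2, ← mul_assoc, ← pow_add, ← two_mul, pow_mul]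
  simp

theorem loj_disc (p : ℕ) : ∃ Q : ℕ → MvPolynomial (Fin p) ℝ,
    ∀ (a : Fin p → ℝ) (α : Fin p → ℂ),
      (∀ z : ℂ, z ^ p + ∑ i, (a i : ℂ) * z ^ (i : ℕ) = ∏ i, (z - α i)) →
      ∀ k, ((MvPolynomial.eval a (Q k) : ℝ) : ℂ) = lojD α k := by
  suffices H : ∀ k, ∃ Q : MvPolynomial (Fin p) ℝ, ∀ (a : Fin p → ℝ) (α : Fin p → ℂ),
      (∀ z : ℂ, z ^ p + ∑ i, (a i : ℂ) * z ^ (i : ℕ) = ∏ i, (z - α i)) →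
      ((MvPolynomial.eval a Q : ℝ) : ℂ) = lojD α k by
    choose Q hQ using H
    exact ⟨Q, fun a α h k => hQ k a α h⟩
  intro k
  let Δ : MvPolynomial (Fin p) ℝ := ∑ I ∈ Finset.powersetCard k (Finset.univ : Finset (Fin p)),
    ∏ x ∈ I.offDiag, (MvPolynomial.X x.1 - MvPolynomial.X x.2)
  have hsym : Δ.IsSymmetric := by
    intro e
    simp only [Δ, map_sum, map_prod, map_sub, MvPolynomial.rename_X]
    refine Finset.sum_bij' (fun I _ => I.map e.toEmbedding) (fun I _ => I.map e.symm.toEmbedding)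
      ?_ ?_ ?_ ?_ ?_
    · intro I hI; simpa [Finset.mem_powersetCard] using hI
    · intro I hI; simpa [Finset.mem_powersetCard] using hI
    · intro I _; ext; simp
    · intro I _; ext; simp
    · intro I _
      refine Finset.prod_bij' (fun x _ => (e x.1, e x.2)) (fun x _ => (e.symm x.1, e.symm x.2))
        ?_ ?_ ?_ ?_ ?_
      · intro x hx; simpa [Finset.mem_offDiag] using hx
      · rintro ⟨x, y⟩ hx
        simp only [Finset.mem_offDiag, Finset.mem_map_equiv] at hx ⊢
        exact ⟨hx.1, hx.2.1, fun h => hx.2.2 (e.symm.injective h)⟩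
      · intro x _; simp
      · intro x _; simp
      · intro x _; simp
  obtain ⟨q, hq⟩ := MvPolynomial.esymmAlgHom_fin_surjective (R := ℝ) (le_refl p) ⟨Δ, hsym⟩
  have hq' : MvPolynomial.aeval (fun i : Fin p => MvPolynomial.esymm (Fin p) ℝ (i + 1)) q = Δ := by
    rw [← MvPolynomial.esymmAlgHom_apply, hq]
  refine ⟨MvPolynomial.aeval (fun i : Fin p =>
    MvPolynomial.C ((-1) ^ ((i : ℕ) + 1)) * MvPolynomial.X (Fin.rev i)) q, fun a α h => ?_⟩
  have h1 : MvPolynomial.aeval α Δ = lojD α k := by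
    simp [Δ, lojD]
  rw [← h1, ← hq']
  have h2 : (MvPolynomial.aeval α) (MvPolynomial.aeval
      (fun i : Fin p => MvPolynomial.esymm (Fin p) ℝ (i + 1)) q) =
      MvPolynomial.aeval (fun i : Fin p => (-1) ^ ((i : ℕ) + 1) * (a (Fin.rev i) : ℂ)) q := by
    rw [← AlgHom.comp_apply, MvPolynomial.comp_aeval]
    congr 2
    funext i
    exact loj_vieta a α h i
  rw [h2]
  have h3 : ∀ P : MvPolynomial (Fin p) ℝ, ((MvPolynomial.eval a P : ℝ) : ℂ) =
      MvPolynomial.aeval (fun i => (a i : ℂ)) P := by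
    intro P
    have := MvPolynomial.aeval_algebraMap_apply (A := ℝ) ℂ a P
    simpa [MvPolynomial.aeval_def] using! this.symm
  rw [h3, ← AlgHom.comp_apply, MvPolynomial.comp_aeval]
  congr 2
  funext i
  simp

theorem loj_enum {p : ℕ} (s : Multiset ℂ) (hs : Multiset.card s = p) : ∃ α : Fin p → ℂ,
    ∀ z : ℂ, (s.map fun r => z - r).prod = ∏ i, (z - α i) := by
  induction s using Quotient.inductionOn with
  | h l =>
    have hl : l.length = p := hs
    subst hl
    refine ⟨fun i => l[i.1], fun z => ?_⟩
    rw [Fin.prod_univ_fun_getElem l (fun r => z - r)]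
    rfl

theorem loj_roots {p : ℕ} (a : Fin p → ℝ) : ∃ α : Fin p → ℂ,
    ∀ z : ℂ, z ^ p + ∑ i, (a i : ℂ) * z ^ (i : ℕ) = ∏ i, (z - α i) := by
  set P : Polynomial ℂ := Polynomial.X ^ p +
    ∑ i : Fin p, Polynomial.C (a i : ℂ) * Polynomial.X ^ (i : ℕ) with hP
  have hdeg : (∑ i : Fin p, Polynomial.C (a i : ℂ) * Polynomial.X ^ (i : ℕ) : Polynomial ℂ).degree <
      (p : WithBot ℕ) := by
    refine lt_of_le_of_lt (Polynomial.degree_sum_le _ _) ?_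
    rw [Finset.sup_lt_iff (by exact_mod_cast WithBot.bot_lt_coe p)]
    intro i _
    refine lt_of_le_of_lt (Polynomial.degree_C_mul_X_pow_le _ _) ?_
    exact_mod_cast i.2
  have hmon : P.Monic := Polynomial.monic_X_pow_add hdeg
  have hnd : P.natDegree = p := by
    rw [hP, Polynomial.natDegree_add_eq_left_of_degree_lt] <;> simp [hdeg]
  have hspl : P.Splits := IsAlgClosed.splits P
  have hcard : Multiset.card P.roots = p := by
    rw [← hnd]; exact hspl.natDegree_eq_card_roots.symm
  have hprod : P = (P.roots.map fun r => Polynomial.X - Polynomial.C r).prod := by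
    have := hspl.eq_prod_roots
    rwa [hmon.leadingCoeff, Polynomial.C_1, one_mul] at this
  obtain ⟨α, hα⟩ := loj_enum P.roots hcard
  refine ⟨α, fun z => ?_⟩
  have h1 : P.eval z = z ^ p + ∑ i, (a i : ℂ) * z ^ (i : ℕ) := by
    simp [hP, Polynomial.eval_finsetSum]
  rw [← h1, ← hα]
  conv_lhs => rw [hprod]
  rw [Polynomial.eval_multiset_prod, Multiset.map_map]
  simp

theorem loj_prod_zero {p : ℕ} (α : Fin p → ℂ) (I : Finset (Fin p)) {i j : Fin p} (hi : i ∈ I)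
    (hj : j ∈ I) (hij : i ≠ j) (h : α i = α j) : ∏ x ∈ I.offDiag, (α x.1 - α x.2) = 0 :=
  Finset.prod_eq_zero (i := (i, j)) (Finset.mem_offDiag.2 ⟨hi, hj, hij⟩) (by simp [h])

/-- The `s`-th generalized discriminant does not vanish, `s` the number of distinct values. -/
theorem lojD_ne_zero {p : ℕ} (α : Fin p → ℂ) : lojD α (Finset.univ.image α).card ≠ 0 := by
  classical
  set V := Finset.univ.image α with hV
  set w : ℂ := ∏ x ∈ V.offDiag, (x.1 - x.2) with hw
  have hw0 : w ≠ 0 := by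
    refine Finset.prod_ne_zero_iff.2 fun x hx => ?_
    exact sub_ne_zero.2 (Finset.mem_offDiag.1 hx).2.2
  set S := Finset.powersetCard V.card (Finset.univ : Finset (Fin p)) with hS
  have hterm : ∀ I ∈ S, ∏ x ∈ I.offDiag, (α x.1 - α x.2) =
      if Set.InjOn α I then w else 0 := by
    intro I hI
    split_ifs with hinj
    · have him : I.image α = V := by
        refine Finset.eq_of_subset_of_card_le (Finset.image_subset_image (Finset.subset_univ _)) ?_
        rw [Finset.card_image_of_injOn hinj, (Finset.mem_powersetCard.1 hI).2]
      rw [hw, ← him]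
      refine Finset.prod_bij (fun x _ => (α x.1, α x.2)) ?_ ?_ ?_ ?_
      · intro x hx
        obtain ⟨h1, h2, h3⟩ := Finset.mem_offDiag.1 hx
        exact Finset.mem_offDiag.2 ⟨Finset.mem_image_of_mem _ h1, Finset.mem_image_of_mem _ h2,
          fun h => h3 (hinj h1 h2 h)⟩
      · intro x hx y hy hxy
        obtain ⟨h1, h2, h3⟩ := Finset.mem_offDiag.1 hx
        obtain ⟨h4, h5, h6⟩ := Finset.mem_offDiag.1 hy
        have := Prod.ext_iff.1 hxy
        exact Prod.ext (hinj h1 h4 this.1) (hinj h2 h5 this.2)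
      · rintro ⟨b, c⟩ hb
        obtain ⟨h1, h2, h3⟩ := Finset.mem_offDiag.1 hb
        obtain ⟨i, hi, rfl⟩ := Finset.mem_image.1 h1
        obtain ⟨j, hj, rfl⟩ := Finset.mem_image.1 h2
        exact ⟨(i, j), Finset.mem_offDiag.2 ⟨hi, hj, fun h => h3 (by simpa using congrArg α h)⟩, rfl⟩
      · intro x _; rfl
    · simp only [Set.InjOn, not_forall] at hinj
      obtain ⟨i, hi, j, hj, h, hne⟩ := hinj
      exact loj_prod_zero α I hi hj hne h
  have hsum : lojD α V.card = ((S.filter fun I : Finset (Fin p) => Set.InjOn α (I : Set (Fin p))).card : ℂ) * w := by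
    rw [lojD, Finset.sum_congr rfl hterm, ← Finset.sum_filter, Finset.sum_const, nsmul_eq_mul]
  rw [hsum]
  refine mul_ne_zero ?_ hw0
  rw [Nat.cast_ne_zero]
  refine Finset.card_ne_zero.2 ?_
  obtain ⟨I, -, hI1, hI2⟩ : ∃ I ⊆ (Finset.univ : Finset (Fin p)), I.image α = V ∧ Set.InjOn α I := by
    obtain ⟨I, h1, h2, h3⟩ := Finset.exists_subset_injOn_image_eq_of_surjOn (f := α)
      (Finset.univ : Finset (Fin p)) V (by
        intro x hx
        obtain ⟨i, _, rfl⟩ := Finset.mem_image.1 hx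
        exact ⟨i, by simp, rfl⟩)
    exact ⟨I, Finset.subset_univ _, by exact_mod_cast h3, h2⟩
  refine ⟨I, Finset.mem_filter.2 ⟨Finset.mem_powersetCard.2 ⟨Finset.subset_univ _, ?_⟩, hI2⟩⟩
  rw [← hI1, Finset.card_image_of_injOn hI2]

theorem lojD_bound {p : ℕ} (α : Fin p → ℂ) (hα : ∀ i, ‖α i‖ ≤ 1 / 2) (r : ℕ)
    (hr : ∀ k, r < k → lojD α k = 0) (i j : Fin p) (hij : α i ≠ α j) :
    ‖lojD α r‖ ≤ 2 ^ p * ‖α i - α j‖ := by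
  classical
  have hs : (Finset.univ.image α).card ≤ r := by
    by_contra hcon
    exact lojD_ne_zero α (hr _ (by omega))
  have hterm : ∀ I ∈ Finset.powersetCard r (Finset.univ : Finset (Fin p)),
      ‖∏ x ∈ I.offDiag, (α x.1 - α x.2)‖ ≤ ‖α i - α j‖ := by
    intro I hI
    by_cases hinj : Set.InjOn α I
    · have him : I.image α = Finset.univ.image α := by
        refine Finset.eq_of_subset_of_card_le (Finset.image_subset_image (Finset.subset_univ _)) ?_
        rw [Finset.card_image_of_injOn hinj, (Finset.mem_powersetCard.1 hI).2]
        exact hs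
      have hi : α i ∈ I.image α := him ▸ Finset.mem_image_of_mem _ (Finset.mem_univ i)
      have hj : α j ∈ I.image α := him ▸ Finset.mem_image_of_mem _ (Finset.mem_univ j)
      obtain ⟨i', hi', h1⟩ := Finset.mem_image.1 hi
      obtain ⟨j', hj', h2⟩ := Finset.mem_image.1 hj
      have hne : i' ≠ j' := by
        rintro rfl
        exact hij (h1.symm.trans h2)
      have hmem : (i', j') ∈ I.offDiag := Finset.mem_offDiag.2 ⟨hi', hj', hne⟩
      rw [← Finset.mul_prod_erase _ _ hmem, norm_mul]
      simp only [h1, h2]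
      refine mul_le_of_le_one_right (norm_nonneg _) ?_
      rw [norm_prod]
      refine Finset.prod_le_one (fun _ _ => norm_nonneg _) fun x _ => ?_
      refine (norm_sub_le _ _).trans ?_
      linarith [hα x.1, hα x.2]
    · simp only [Set.InjOn, not_forall] at hinj
      obtain ⟨i, hi, j, hj, h, hne⟩ := hinj
      rw [loj_prod_zero α I hi hj hne h]
      simp
  refine (norm_sum_le_of_le _ hterm).trans ?_
  rw [Finset.sum_const, nsmul_eq_mul]
  gcongr
  have : (Finset.powersetCard r (Finset.univ : Finset (Fin p))).card ≤ 2 ^ p := by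
    refine (Finset.card_le_card (Finset.subset_univ _)).trans ?_
    simp
  exact_mod_cast this

theorem loj_card_le {p : ℕ} (α : Fin p → ℂ) (r : ℕ) (hr : ∀ k, r < k → lojD α k = 0) :
    (Finset.univ.image α).card ≤ r := by
  by_contra hcon
  exact lojD_ne_zero α (hr _ (by omega))

/-- Value of the monic polynomial with lower coefficients `a`. -/
noncomputable def lojP {p : ℕ} (a : Fin p → ℝ) (t : ℝ) : ℝ := t ^ p + ∑ i, a i * t ^ (i : ℕ)

theorem loj_root_small {p : ℕ} (a : Fin p → ℝ) (ha : 2 ^ p * ∑ i, |a i| < 1) (z : ℂ)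
    (hz : z ^ p + ∑ i, (a i : ℂ) * z ^ (i : ℕ) = 0) : ‖z‖ ≤ 1 / 2 := by
  by_contra hcon
  push Not at hcon
  have hz0 : 0 < ‖z‖ := by linarith
  have h1 : ‖z‖ ^ p ≤ ∑ i, |a i| * ‖z‖ ^ (i : ℕ) := by
    have : z ^ p = -∑ i, (a i : ℂ) * z ^ (i : ℕ) := eq_neg_of_add_eq_zero_left hz
    rw [← norm_pow, this, norm_neg]
    refine (norm_sum_le _ _).trans_eq ?_
    simp
  have h2 : ∀ i : Fin p, ‖z‖ ^ (i : ℕ) ≤ 2 ^ p * ‖z‖ ^ p := by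
    intro i
    have h3 : (1 : ℝ) ≤ (2 * ‖z‖) ^ (p - i) := one_le_pow₀ (by linarith)
    have h4 : (2 : ℝ) ^ (p - i) ≤ 2 ^ p := pow_le_pow_right₀ (by norm_num) (by omega)
    calc ‖z‖ ^ (i : ℕ) ≤ ‖z‖ ^ (i : ℕ) * (2 * ‖z‖) ^ (p - i) := le_mul_of_one_le_right (by positivity) h3
      _ = 2 ^ (p - i) * (‖z‖ ^ (i : ℕ) * ‖z‖ ^ (p - i)) := by rw [mul_pow]; ring
      _ = 2 ^ (p - i) * ‖z‖ ^ p := by rw [← pow_add]; congr 2; omega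
      _ ≤ _ := by gcongr
  have h5 : ∑ i, |a i| * ‖z‖ ^ (i : ℕ) ≤ (2 ^ p * ∑ i, |a i|) * ‖z‖ ^ p := by
    rw [Finset.mul_sum, Finset.sum_mul]
    refine Finset.sum_le_sum fun i _ => ?_
    calc |a i| * ‖z‖ ^ (i : ℕ) ≤ |a i| * (2 ^ p * ‖z‖ ^ p) := by gcongr; exact h2 i
      _ = _ := by ring
  have h6 : 0 < ‖z‖ ^ p := by positivity
  nlinarith

theorem loj_point {p : ℕ} (hp : 1 ≤ p) (Q : ℕ → MvPolynomial (Fin p) ℝ)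
    (hQ : ∀ (a : Fin p → ℝ) (α : Fin p → ℂ),
      (∀ z : ℂ, z ^ p + ∑ i, (a i : ℂ) * z ^ (i : ℕ) = ∏ i, (z - α i)) →
      ∀ k, ((MvPolynomial.eval a (Q k) : ℝ) : ℂ) = lojD α k)
    (a : Fin p → ℝ) (ha : 2 ^ p * ∑ i, |a i| < 1) (t : ℝ) (r : ℕ)
    (hr : ∀ k, r < k → MvPolynomial.eval a (Q k) = 0) :
    (∃ s : ℝ, lojP a s = 0 ∧ |t - s| ^ p ≤ |lojP a t|) ∨
    (2 ≤ r ∧ |MvPolynomial.eval a (Q r)| ^ p ≤ (2 ^ p * 2) ^ p * |lojP a t|) := by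
  obtain ⟨α, hα⟩ := loj_roots a
  have hroot : ∀ i, (α i) ^ p + ∑ j, (a j : ℂ) * (α i) ^ (j : ℕ) = 0 := by
    intro i
    rw [hα]
    exact Finset.prod_eq_zero (Finset.mem_univ i) (by simp)
  have hreal : ∀ s : ℝ, ((lojP a s : ℝ) : ℂ) = ∏ i, ((s : ℂ) - α i) := by
    intro s
    rw [← hα]
    simp [lojP]
  have hD := hQ a α hα
  have hr' : ∀ k, r < k → lojD α k = 0 := by
    intro k hk
    rw [← hD, hr k hk]; simp
  have hne : (Finset.univ : Finset (Fin p)).Nonempty := ⟨⟨0, hp⟩, Finset.mem_univ _⟩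
  obtain ⟨i, -, hi⟩ := Finset.exists_min_image Finset.univ (fun i => ‖(t : ℂ) - α i‖) hne
  have hpow : ‖(t : ℂ) - α i‖ ^ p ≤ |lojP a t| := by
    have h1 : |lojP a t| = ∏ i, ‖(t : ℂ) - α i‖ := by
      rw [← norm_prod, ← hreal, Complex.norm_real, Real.norm_eq_abs]
    rw [h1]
    calc ‖(t : ℂ) - α i‖ ^ p = ∏ _j : Fin p, ‖(t : ℂ) - α i‖ := by simp
      _ ≤ _ := Finset.prod_le_prod (fun _ _ => norm_nonneg _) fun j hj => hi j hj
  by_cases him : (α i).im = 0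
  · left
    have hre : α i = ((α i).re : ℂ) := Complex.ext (by simp) (by simp [him])
    refine ⟨(α i).re, ?_, ?_⟩
    · have h1 := hreal (α i).re
      rw [← hre, Finset.prod_eq_zero (Finset.mem_univ i) (by simp)] at h1
      exact_mod_cast h1
    · rw [hre, ← Complex.ofReal_sub, Complex.norm_real, Real.norm_eq_abs] at hpow
      exact hpow
  · right
    have hconj : ((starRingEnd ℂ) (α i)) ^ p + ∑ j, (a j : ℂ) * ((starRingEnd ℂ) (α i)) ^ (j : ℕ) = 0 := by
      have h1 := congrArg (starRingEnd ℂ) (hroot i)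
      simpa using h1
    rw [hα, Finset.prod_eq_zero_iff] at hconj
    obtain ⟨j, -, hj⟩ := hconj
    have hj' : (starRingEnd ℂ) (α i) = α j := sub_eq_zero.1 hj
    have hij : α i ≠ α j := by
      intro h
      rw [← h] at hj'
      exact him (Complex.conj_eq_iff_im.1 hj')
    have hdist : ‖α i - α j‖ ≤ 2 * ‖(t : ℂ) - α i‖ := by
      have h1 : α i - α j = ((2 * (α i).im : ℝ) : ℂ) * Complex.I := by
        rw [← hj', Complex.sub_conj]
      rw [h1, norm_mul, Complex.norm_I, mul_one, Complex.norm_real, Real.norm_eq_abs, abs_mul]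
      have h2 := Complex.abs_im_le_norm ((t : ℂ) - α i)
      simp at h2
      simpa using h2
    have hb := lojD_bound α (fun i => loj_root_small a ha _ (hroot i)) r hr' i j hij
    rw [← hD, Complex.norm_real, Real.norm_eq_abs] at hb
    constructor
    · refine le_trans ?_ (loj_card_le α r hr')
      refine Finset.one_lt_card.2 ⟨α i, ?_, α j, ?_, hij⟩ <;>
        exact Finset.mem_image_of_mem _ (Finset.mem_univ _)
    · calc |MvPolynomial.eval a (Q r)| ^ p ≤ (2 ^ p * (2 * ‖(t : ℂ) - α i‖)) ^ p := by
            gcongr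
            exact hb.trans (by gcongr)
        _ = (2 ^ p * 2) ^ p * ‖(t : ℂ) - α i‖ ^ p := by rw [← mul_assoc, mul_pow]
        _ ≤ _ := by gcongr

theorem loj_arith (C1 B C2 L : ℝ) (hC1 : 0 < C1) (hB : 0 < B) (hC2 : 0 < C2) (hL : 0 ≤ L)
    (m1 p m2 : ℕ) (hm1 : 1 ≤ m1) (hp : 1 ≤ p) (hm2 : 1 ≤ m2) :
    ∃ C : ℝ, 1 ≤ C ∧ ∀ δ η g v : ℝ, 0 ≤ δ → 0 ≤ η → 0 ≤ g → 0 ≤ v → g ≤ 1 →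
      δ ^ m1 ≤ C1 * v ^ 2 → v ^ p ≤ B * g → η ^ m2 ≤ C2 * (g + L * δ) →
      (δ + η) ^ (p * (m1 * m2)) ≤ C * g := by
  set N := m1 * p with hN
  have hN1 : 1 ≤ N := Nat.mul_pos hm1 hp
  set A := C1 ^ p * B ^ 2 with hA
  have hA0 : 0 < A := by positivity
  set M := p * (m1 * m2) with hM
  refine ⟨2 ^ (M - 1) * (A ^ m2 + C2 ^ N * (2 ^ (N - 1) * (1 + L ^ N * A))) + 1, ?_, ?_⟩
  · have : 0 ≤ 2 ^ (M - 1) * (A ^ m2 + C2 ^ N * (2 ^ (N - 1) * (1 + L ^ N * A))) := by positivity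
    linarith
  intro δ η g v hδ hη hg hv hg1 h1 h2 h3
  have hgp : ∀ n, 1 ≤ n → g ^ n ≤ g := fun n hn => by
    simpa using pow_le_pow_of_le_one hg hg1 hn
  have h4 : δ ^ N ≤ A * g := by
    calc δ ^ N = (δ ^ m1) ^ p := by rw [hN, pow_mul]
      _ ≤ (C1 * v ^ 2) ^ p := by gcongr
      _ = C1 ^ p * (v ^ p) ^ 2 := by rw [mul_pow, ← pow_mul, ← pow_mul, mul_comm 2 p]
      _ ≤ C1 ^ p * (B * g) ^ 2 := by gcongr
      _ = A * g ^ 2 := by rw [hA]; ring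
      _ ≤ A * g := by gcongr; exact hgp 2 (by norm_num)
  have h5 : δ ^ M ≤ A ^ m2 * g := by
    calc δ ^ M = (δ ^ N) ^ m2 := by rw [hM, hN, ← pow_mul]; congr 1; ring
      _ ≤ (A * g) ^ m2 := by gcongr
      _ = A ^ m2 * g ^ m2 := mul_pow _ _ _
      _ ≤ _ := by gcongr; exact hgp _ hm2
  have h6 : η ^ M ≤ C2 ^ N * (2 ^ (N - 1) * (1 + L ^ N * A)) * g := by
    calc η ^ M = (η ^ m2) ^ N := by rw [hM, hN, ← pow_mul]; congr 1; ring
      _ ≤ (C2 * (g + L * δ)) ^ N := by gcongr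
      _ = C2 ^ N * (g + L * δ) ^ N := mul_pow _ _ _
      _ ≤ C2 ^ N * (2 ^ (N - 1) * (g ^ N + (L * δ) ^ N)) := by
        gcongr; exact add_pow_le hg (by positivity) N
      _ = C2 ^ N * (2 ^ (N - 1) * (g ^ N + L ^ N * δ ^ N)) := by rw [mul_pow L]
      _ ≤ C2 ^ N * (2 ^ (N - 1) * (g + L ^ N * (A * g))) := by gcongr; exact hgp _ hN1
      _ = _ := by ring
  calc (δ + η) ^ M ≤ 2 ^ (M - 1) * (δ ^ M + η ^ M) := add_pow_le hδ hη M
    _ ≤ 2 ^ (M - 1) * (A ^ m2 * g + C2 ^ N * (2 ^ (N - 1) * (1 + L ^ N * A)) * g) := by gcongr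
    _ ≤ _ := by rw [add_mul _ (1 : ℝ), ← add_mul, ← mul_assoc]; linarith

/-- Local Łojasiewicz inequality at the origin. -/
def LojAt {E : Type*} [NormedAddCommGroup E] (f : E → ℝ) : Prop :=
  ∃ (m : ℕ) (C : ℝ), 1 ≤ m ∧ 0 < C ∧ ∀ᶠ x in 𝓝 (0 : E), ∃ y, f y = 0 ∧ ‖x - y‖ ^ m ≤ C * |f x|

theorem loj_near {E : Type*} [NormedAddCommGroup E] (f : E → ℝ) (hf : ContinuousAt f 0)
    (h0 : f 0 = 0) (m : ℕ) (C : ℝ) (hm : 1 ≤ m)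
    (h : ∀ᶠ x in 𝓝 (0 : E), ∃ y, f y = 0 ∧ ‖x - y‖ ^ m ≤ C * |f x|) (ε : ℝ) (hε : 0 < ε) :
    ∀ᶠ x in 𝓝 (0 : E), ∃ y, f y = 0 ∧ ‖x - y‖ ^ m ≤ C * |f x| ∧ ‖y‖ < ε := by
  have h1 : Tendsto (fun x => C * |f x|) (𝓝 0) (𝓝 0) := by
    have : ContinuousAt (fun x => C * |f x|) 0 := continuousAt_const.mul hf.abs
    have h2 := this.tendsto
    simpa [h0] using h2
  have h2 : ∀ᶠ x in 𝓝 (0 : E), C * |f x| < (ε / 2) ^ m := h1.eventually_lt_const (by positivity)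
  have h3 : ∀ᶠ x in 𝓝 (0 : E), ‖x‖ < ε / 2 := by
    have := ball_mem_nhds (0 : E) (half_pos hε)
    filter_upwards [this] with x hx
    simpa using hx
  filter_upwards [h, h2, h3] with x ⟨y, hy, hxy⟩ hx2 hx3
  refine ⟨y, hy, hxy, ?_⟩
  have h4 : ‖x - y‖ < ε / 2 := lt_of_pow_lt_pow_left₀ m (by positivity) (hxy.trans_lt hx2)
  have h5 : ‖y‖ ≤ ‖x‖ + ‖x - y‖ := by
    have := norm_sub_le x (x - y)
    simpa using this
  linarith

theorem loj_eval_big {p : ℕ} (Q : ℕ → MvPolynomial (Fin p) ℝ)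
    (hQ : ∀ (a : Fin p → ℝ) (α : Fin p → ℂ),
      (∀ z : ℂ, z ^ p + ∑ i, (a i : ℂ) * z ^ (i : ℕ) = ∏ i, (z - α i)) →
      ∀ k, ((MvPolynomial.eval a (Q k) : ℝ) : ℂ) = lojD α k)
    (a : Fin p → ℝ) (k : ℕ) (hk : p < k) : MvPolynomial.eval a (Q k) = 0 := by
  obtain ⟨α, hα⟩ := loj_roots a
  have h := hQ a α hα k
  rw [lojD, Finset.powersetCard_eq_empty.2 (by simpa using hk)] at h
  simpa using h

theorem loj_eval_zero {p : ℕ} (Q : ℕ → MvPolynomial (Fin p) ℝ)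
    (hQ : ∀ (a : Fin p → ℝ) (α : Fin p → ℂ),
      (∀ z : ℂ, z ^ p + ∑ i, (a i : ℂ) * z ^ (i : ℕ) = ∏ i, (z - α i)) →
      ∀ k, ((MvPolynomial.eval a (Q k) : ℝ) : ℂ) = lojD α k)
    (k : ℕ) (hk : 2 ≤ k) : MvPolynomial.eval (0 : Fin p → ℝ) (Q k) = 0 := by
  have h := hQ 0 0 (by intro z; simp) k
  have h2 : lojD (0 : Fin p → ℂ) k = 0 := by
    rw [lojD]
    refine Finset.sum_eq_zero fun I hI => ?_
    rw [Finset.mem_powersetCard] at hI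
    obtain ⟨i, hi, j, hj, hij⟩ := Finset.one_lt_card.1 (by omega : 1 < I.card)
    exact Finset.prod_eq_zero (Finset.mem_offDiag.2 ⟨hi, hj, hij⟩ : (i, j) ∈ I.offDiag) (by simp)
  rw [h2] at h
  simpa using h

theorem loj_eval_analytic {E : Type*} [NormedAddCommGroup E] [NormedSpace ℝ E] {p : ℕ}
    (a : E → Fin p → ℝ) (x : E) (ha : AnalyticAt ℝ a x) (q : MvPolynomial (Fin p) ℝ) :
    AnalyticAt ℝ (fun x => MvPolynomial.eval (a x) q) x := by
  have hi : ∀ i, AnalyticAt ℝ (fun x => a x i) x := by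
    intro i
    exact (ContinuousLinearMap.proj (R := ℝ) (φ := fun _ : Fin p => ℝ) i).analyticAt _ |>.comp ha
  induction q using MvPolynomial.induction_on with
  | C c => simpa using analyticAt_const
  | add q1 q2 h1 h2 => simpa using! h1.add h2
  | mul_X q i h => simpa using! h.mul (hi i)

theorem lojP_analytic {E : Type*} [NormedAddCommGroup E] [NormedSpace ℝ E] {p : ℕ}
    (a : E → Fin p → ℝ) (ha : AnalyticAt ℝ a 0) :
    AnalyticAt ℝ (fun z : E × ℝ => lojP (a z.1) z.2) 0 := by
  have h1 : AnalyticAt ℝ (fun z : E × ℝ => z.1) 0 := analyticAt_fst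
  have h2 : AnalyticAt ℝ (fun z : E × ℝ => z.2) 0 := analyticAt_snd
  have hi : ∀ i, AnalyticAt ℝ (fun z : E × ℝ => a z.1 i) 0 := by
    intro i
    have h3 : AnalyticAt ℝ (fun z : E × ℝ => a z.1) 0 := AnalyticAt.comp (g := a) (by simpa using ha) h1
    exact (ContinuousLinearMap.proj (R := ℝ) (φ := fun _ : Fin p => ℝ) i).analyticAt _ |>.comp h3
  unfold lojP
  refine (h2.pow p).add ?_
  exact Finset.analyticAt_fun_sum _ fun i _ => (hi i).mul (h2.pow _)

theorem loj_stratum {E : Type*} [NormedAddCommGroup E] [NormedSpace ℝ E] {p : ℕ} (hp : 1 ≤ p)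
    (ih : ∀ h : E → ℝ, AnalyticAt ℝ h 0 → h 0 = 0 → LojAt h)
    (a : E → Fin p → ℝ) (ha : AnalyticAt ℝ a 0) (ha0 : a 0 = 0)
    (Q : ℕ → MvPolynomial (Fin p) ℝ)
    (hQ : ∀ (a : Fin p → ℝ) (α : Fin p → ℂ),
      (∀ z : ℂ, z ^ p + ∑ i, (a i : ℂ) * z ^ (i : ℕ) = ∏ i, (z - α i)) →
      ∀ k, ((MvPolynomial.eval a (Q k) : ℝ) : ℂ) = lojD α k)
    (r : ℕ) (hr : 1 ≤ r) :
    ∃ (m : ℕ) (C : ℝ), 1 ≤ m ∧ 0 < C ∧ ∀ᶠ z in 𝓝 (0 : E × ℝ),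
      (∀ k, r < k → MvPolynomial.eval (a z.1) (Q k) = 0) →
      ∃ y : E × ℝ, lojP (a y.1) y.2 = 0 ∧ ‖z - y‖ ^ m ≤ C * |lojP (a z.1) z.2| := by
  have hG := lojP_analytic a ha
  have hG0 : lojP (a (0 : E × ℝ).1) (0 : E × ℝ).2 = 0 := by
    simp [lojP, ha0]; omega
  have hfst : Tendsto (fun z : E × ℝ => z.1) (𝓝 0) (𝓝 0) := continuous_fst.tendsto' _ _ rfl
  have hsmall : ∀ᶠ z in 𝓝 (0 : E × ℝ), 2 ^ p * ∑ i, |a z.1 i| < 1 := by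
    have h1 : ContinuousAt (fun x => (2 : ℝ) ^ p * ∑ i, |a x i|) 0 := by
      have := ha.continuousAt
      have h2 : ∀ i, ContinuousAt (fun x => a x i) 0 := fun i => (continuousAt_pi.1 this) i
      refine continuousAt_const.mul ?_
      exact tendsto_finsetSum _ fun i _ => (h2 i).abs
    have h2 : ∀ᶠ x in 𝓝 (0 : E), (2 : ℝ) ^ p * ∑ i, |a x i| < 1 :=
      h1.eventually_lt_const (by simp [ha0])
    exact hfst.eventually h2
  have hone : ∀ᶠ z in 𝓝 (0 : E × ℝ), |lojP (a z.1) z.2| < 1 :=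
    hG.continuousAt.abs.eventually_lt_const (by beta_reduce; rw [hG0]; simp)
  induction r, hr using Nat.le_induction with
  | base =>
    refine ⟨p, 1, hp, one_pos, ?_⟩
    filter_upwards [hsmall] with z hz hcond
    rcases loj_point hp Q hQ (a z.1) hz z.2 1 hcond with ⟨s, hs, hts⟩ | ⟨h, -⟩
    · refine ⟨(z.1, s), hs, ?_⟩
      simpa [Prod.norm_def] using hts
    · omega
  | succ r hr IH =>
    obtain ⟨m2, C2, hm2, hC2, IH⟩ := IH
    set h : E → ℝ := fun x => ∑ k ∈ Finset.Ioc r p, (MvPolynomial.eval (a x) (Q k)) ^ 2 with hh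
    have hhA : AnalyticAt ℝ h 0 :=
      Finset.analyticAt_fun_sum _ fun k _ => (loj_eval_analytic a 0 ha (Q k)).pow 2
    have hh0 : h 0 = 0 := by
      refine Finset.sum_eq_zero fun k hk => ?_
      rw [Finset.mem_Ioc] at hk
      rw [ha0, loj_eval_zero Q hQ k (by omega)]; simp
    obtain ⟨m1, C1, hm1, hC1, hL⟩ := ih h hhA hh0
    obtain ⟨L, S, hS, hLip⟩ := (hG.contDiffAt (n := 1)).exists_lipschitzOnWith
    obtain ⟨C, hC, hmain⟩ := loj_arith C1 ((2 ^ p * 2) ^ p) C2 L hC1 (by positivity) hC2 L.2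
      m1 p m2 hm1 hp hm2
    obtain ⟨ε, hε, hball⟩ := Metric.mem_nhds_iff.1 (inter_mem IH hS)
    have hnear := loj_near h hhA.continuousAt hh0 m1 C1 hm1 hL ε hε
    refine ⟨p * (m1 * m2), C, by nlinarith [Nat.mul_pos hp (Nat.mul_pos hm1 hm2)], by linarith, ?_⟩
    filter_upwards [hsmall, hone, hfst.eventually hnear, ball_mem_nhds (0 : E × ℝ) hε]
      with z hz hz1 ⟨y1, hy1, hzy1, hyn⟩ hzb hcond
    have hzS := (hball hzb).2
    rcases loj_point hp Q hQ (a z.1) hz z.2 (r + 1) hcond with ⟨s, hs, hts⟩ | ⟨-, hv⟩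
    · refine ⟨(z.1, s), hs, ?_⟩
      have h1 : ‖z - (z.1, s)‖ = |z.2 - s| := by simp [Prod.norm_def]
      rw [h1, pow_mul]
      have hg0 := abs_nonneg (lojP (a z.1) z.2)
      calc (|z.2 - s| ^ p) ^ (m1 * m2) ≤ |lojP (a z.1) z.2| ^ (m1 * m2) := by gcongr
        _ ≤ |lojP (a z.1) z.2| := pow_le_of_le_one hg0 hz1.le (Nat.mul_pos hm1 hm2).ne'
        _ ≤ C * |lojP (a z.1) z.2| := le_mul_of_one_le_left hg0 hC
    · have hzb' : ‖z‖ < ε := by simpa using hzb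
      have hyb : (y1, z.2) ∈ ball (0 : E × ℝ) ε := by
        rw [mem_ball_zero_iff, Prod.norm_def]
        exact max_lt hyn ((norm_snd_le z).trans_lt hzb')
      obtain ⟨hyI, hyS⟩ := hball hyb
      have hcy : ∀ k, r < k → MvPolynomial.eval (a y1) (Q k) = 0 := by
        intro k hk
        by_cases hkp : k ≤ p
        · have := (Finset.sum_eq_zero_iff_of_nonneg (fun k _ => sq_nonneg _)).1 hy1 k
            (Finset.mem_Ioc.2 ⟨hk, hkp⟩)
          simpa using this
        · exact loj_eval_big Q hQ _ k (by omega)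
      obtain ⟨y, hy, hyy⟩ := hyI hcy
      refine ⟨y, hy, ?_⟩
      have hd : ‖z - (y1, z.2)‖ = ‖z.1 - y1‖ := by simp [Prod.norm_def]
      have htri : ‖z - y‖ ≤ ‖z.1 - y1‖ + ‖(y1, z.2) - y‖ := by
        rw [← hd]; exact norm_sub_le_norm_sub_add_norm_sub _ _ _
      have hhx : |h z.1| ≤ |MvPolynomial.eval (a z.1) (Q (r + 1))| ^ 2 := by
        rw [abs_of_nonneg (Finset.sum_nonneg fun k _ => sq_nonneg _), sq_abs]
        have : ∀ k ∈ Finset.Ioc r p, (MvPolynomial.eval (a z.1) (Q k)) ^ 2 =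
            if k = r + 1 then (MvPolynomial.eval (a z.1) (Q (r + 1))) ^ 2 else 0 := by
          intro k hk
          split_ifs with hkr
          · rw [hkr]
          · rw [Finset.mem_Ioc] at hk
            rw [hcond k (by omega)]; simp
        rw [hh]
        simp only
        rw [Finset.sum_congr rfl this, Finset.sum_ite_eq']
        split_ifs
        · exact le_rfl
        · positivity
      have hGl : |lojP (a y1) z.2| ≤ |lojP (a z.1) z.2| + L * ‖z.1 - y1‖ := by
        have h1 := hLip.dist_le_mul _ hyS _ hzS
        rw [dist_comm (y1, z.2), dist_eq_norm z, hd, Real.dist_eq] at h1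
        have h2 := abs_sub_abs_le_abs_sub (lojP (a y1) z.2) (lojP (a z.1) z.2)
        simp only at h1
        linarith
      have hres := hmain ‖z.1 - y1‖ ‖(y1, z.2) - y‖ |lojP (a z.1) z.2|
        |MvPolynomial.eval (a z.1) (Q (r + 1))| (norm_nonneg _) (norm_nonneg _) (abs_nonneg _)
        (abs_nonneg _) hz1.le (hzy1.trans (by gcongr)) hv (hyy.trans (by simp only; gcongr))
      exact (pow_le_pow_left₀ (norm_nonneg _) htri _).trans hres

theorem loj_step {E : Type*} [NormedAddCommGroup E] [NormedSpace ℝ E]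
    (ih : ∀ h : E → ℝ, AnalyticAt ℝ h 0 → h 0 = 0 → LojAt h)
    {p : ℕ} (hp : 1 ≤ p) (a : E → Fin p → ℝ) (ha : AnalyticAt ℝ a 0) (ha0 : a 0 = 0) :
    LojAt (fun z : E × ℝ => lojP (a z.1) z.2) := by
  obtain ⟨Q, hQ⟩ := loj_disc p
  obtain ⟨m, C, hm, hC, h⟩ := loj_stratum hp ih a ha ha0 Q hQ p hp
  refine ⟨m, C, hm, hC, ?_⟩
  filter_upwards [h] with z hz
  exact hz fun k hk => loj_eval_big Q hQ _ k hk

theorem loj_unit {F : Type*} [NormedAddCommGroup F] (f G U : F → ℝ) (hG : ContinuousAt G 0)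
    (hG0 : G 0 = 0) (c : ℝ) (hc : 0 < c) (h : ∀ᶠ z in 𝓝 (0 : F), f z = G z * U z ∧ c ≤ |U z|)
    (hL : LojAt G) : LojAt f := by
  obtain ⟨m, C, hm, hC, hL⟩ := hL
  obtain ⟨ε, hε, hball⟩ := Metric.mem_nhds_iff.1 h
  refine ⟨m, C / c, hm, by positivity, ?_⟩
  filter_upwards [h, loj_near G hG hG0 m C hm hL ε hε] with z hz ⟨y, hy, hzy, hyn⟩
  refine ⟨y, ?_, hzy.trans ?_⟩
  · have : y ∈ ball (0 : F) ε := by simpa using hyn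
    rw [(hball this).1, hy, zero_mul]
  · rw [hz.1, abs_mul, div_mul_eq_mul_div, le_div_iff₀ hc]
    have := mul_le_mul_of_nonneg_left hz.2 (mul_nonneg hC.le (abs_nonneg (G z)))
    nlinarith

theorem loj_transfer {E F : Type*} [NormedAddCommGroup E] [NormedSpace ℝ E]
    [NormedAddCommGroup F] [NormedSpace ℝ F] (L : F ≃L[ℝ] E) (f : E → ℝ)
    (h : LojAt (fun z => f (L z))) : LojAt f := by
  obtain ⟨m, C, hm, hC, h⟩ := h
  have ht : Tendsto (fun x => L.symm x) (𝓝 0) (𝓝 0) := L.symm.continuous.tendsto' _ _ (by simp)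
  set M : ℝ := ‖(L : F →L[ℝ] E)‖ + 1 with hM
  have hM0 : 0 < M := by positivity
  refine ⟨m, M ^ m * C, hm, by positivity, ?_⟩
  filter_upwards [ht.eventually h] with x ⟨y, hy, hxy⟩
  refine ⟨L y, hy, ?_⟩
  have h1 : ‖x - L y‖ ≤ M * ‖L.symm x - y‖ := by
    have h2 := (L : F →L[ℝ] E).le_opNorm (L.symm x - y)
    have h3 : (L : F →L[ℝ] E) (L.symm x - y) = x - L y := by simp
    rw [h3] at h2
    refine h2.trans ?_
    gcongr
    linarith
  calc ‖x - L y‖ ^ m ≤ (M * ‖L.symm x - y‖) ^ m := by gcongr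
    _ = M ^ m * ‖L.symm x - y‖ ^ m := mul_pow _ _ _
    _ ≤ M ^ m * (C * |f x|) := by gcongr; simpa using hxy
    _ = _ := by ring

theorem loj_regular {E : Type*} [NormedAddCommGroup E] [NormedSpace ℝ E]
    (ih : ∀ h : E → ℝ, AnalyticAt ℝ h 0 → h 0 = 0 → LojAt h) (g : E × ℝ → ℝ)
    (hg : AnalyticAt ℝ g 0) (h0 : g 0 = 0) (hn : ¬ ∀ᶠ t in 𝓝 (0 : ℝ), g (0, t) = 0) :
    LojAt g := by
  obtain ⟨ρ, p, a, c, U, hρ, hp, hc, ha, ha0, h⟩ := loj_weier g hg h0 hn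
  let L : (E × ℝ) ≃L[ℝ] (E × ℝ) :=
    (ContinuousLinearEquiv.refl ℝ E).prodCongr (ContinuousLinearEquiv.unitsEquivAut ℝ (Units.mk0 ρ hρ.ne'))
  refine loj_transfer L g ?_
  have hLz : ∀ z : E × ℝ, L z = (z.1, ρ * z.2) := by
    intro z
    simp [L, mul_comm]
  simp only [hLz]
  refine loj_unit _ (fun z : E × ℝ => lojP (a z.1) z.2) U (lojP_analytic a ha).continuousAt ?_ c hc h
    (loj_step ih hp a ha ha0)
  simp [lojP, ha0]; omega

theorem loj_direction {E : Type*} [NormedAddCommGroup E] [NormedSpace ℝ E] (f : E → ℝ)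
    (hf : AnalyticAt ℝ f 0) (hn : ¬ ∀ᶠ x in 𝓝 (0 : E), f x = 0) :
    ∃ e : E, ¬ ∀ᶠ t in 𝓝 (0 : ℝ), f (t • e) = 0 := by
  obtain ⟨ε, hε, hball⟩ := Metric.mem_nhds_iff.1 hf.eventually_analyticAt
  by_contra hcon
  push Not at hcon
  apply hn
  filter_upwards [ball_mem_nhds (0 : E) hε] with e he
  have hA : AnalyticOnNhd ℝ (fun t : ℝ => f (t • e)) (Set.Icc 0 1) := by
    intro t ht
    have h1 : AnalyticAt ℝ (fun t : ℝ => t • e) t := analyticAt_id.smul analyticAt_const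
    have h2 : AnalyticAt ℝ f (t • e) := by
      apply hball
      rw [mem_ball_zero_iff] at he ⊢
      rw [norm_smul, Real.norm_eq_abs, abs_of_nonneg ht.1]
      exact (mul_le_of_le_one_left (norm_nonneg _) ht.2).trans_lt he
    exact AnalyticAt.comp (g := f) (f := fun t : ℝ => t • e) h2 h1
  have := hA.eqOn_zero_of_preconnected_of_eventuallyEq_zero isPreconnected_Icc
    (by simp : (0 : ℝ) ∈ Set.Icc (0 : ℝ) 1) (hcon e) (by simp : (1 : ℝ) ∈ Set.Icc (0 : ℝ) 1)
  simpa using this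

theorem loj_local (n : ℕ) : ∀ f : (Fin n → ℝ) → ℝ, AnalyticAt ℝ f 0 → f 0 = 0 → LojAt f := by
  have triv : ∀ (n : ℕ) (f : (Fin n → ℝ) → ℝ), (∀ᶠ x in 𝓝 0, f x = 0) → LojAt f := by
    intro n f h
    refine ⟨1, 1, le_rfl, one_pos, ?_⟩
    filter_upwards [h] with x hx
    exact ⟨x, hx, by simp⟩
  induction n with
  | zero =>
    intro f _ h0
    refine triv 0 f (Eventually.of_forall fun x => ?_)
    rw [Subsingleton.elim x 0, h0]
  | succ n ih =>
    intro f hf h0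
    by_cases hz : ∀ᶠ x in 𝓝 0, f x = 0
    · exact triv _ f hz
    obtain ⟨e, he⟩ := loj_direction f hf hz
    have he0 : e ≠ 0 := by
      rintro rfl
      exact he (Eventually.of_forall fun t => by simpa using h0)
    let L0 : ((Fin n → ℝ) × ℝ) ≃L[ℝ] (Fin (n + 1) → ℝ) :=
      ContinuousLinearEquiv.ofFinrankEq (by simp)
    have hL0 : L0 (0, 1) ≠ 0 := by
      rw [Ne, L0.map_eq_zero_iff]
      simp
    obtain ⟨A, hA⟩ := SeparatingDual.exists_continuousLinearEquiv_apply_eq (R := ℝ) hL0 he0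
    let L := L0.trans A
    refine loj_transfer L f (loj_regular ih _ ?_ ?_ ?_)
    · exact AnalyticAt.comp (g := f) (by simpa using hf) (L.analyticAt 0)
    · simpa using h0
    · have : ∀ t : ℝ, L (0, t) = t • e := by
        intro t
        have h1 : ((0 : Fin n → ℝ), t) = t • ((0 : Fin n → ℝ), (1 : ℝ)) := by simp
        rw [h1, L.map_smul]
        congr 1
      simpa only [this] using he

theorem loj_euclid {d : ℕ} (f : EuclideanSpace ℝ (Fin d) → ℝ) (hf : AnalyticAt ℝ f 0)
    (h0 : f 0 = 0) : LojAt f := by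
  let L := (EuclideanSpace.equiv (Fin d) ℝ).symm
  refine loj_transfer L f (loj_local d _ ?_ ?_)
  · exact AnalyticAt.comp (g := f) (by simpa using hf) (L.analyticAt 0)
  · simpa using h0

theorem loj_at_point {d : ℕ} {V : Set (EuclideanSpace ℝ (Fin d))} (hV : IsOpen V)
    (f : EuclideanSpace ℝ (Fin d) → ℝ) (a : EuclideanSpace ℝ (Fin d)) (haV : a ∈ V)
    (hf : AnalyticAt ℝ f a) :
    ∃ (m : ℕ) (C : ℝ), 1 ≤ m ∧ 0 < C ∧ ∀ᶠ x in 𝓝 a,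
      (min (infDist x {y ∈ V | f y = 0}) 1) ^ m ≤ C * |f x| := by
  by_cases h0 : f a = 0
  · set g : EuclideanSpace ℝ (Fin d) → ℝ := fun x => f (a + x) with hg
    have hgA : AnalyticAt ℝ g 0 :=
      AnalyticAt.comp (g := f) (by simpa using hf) (analyticAt_const.add analyticAt_id)
    have hg0 : g 0 = 0 := by simp [hg, h0]
    obtain ⟨m, C, hm, hC, h⟩ := loj_euclid g hgA hg0
    obtain ⟨ε, hε, hball⟩ := Metric.mem_nhds_iff.1 (hV.mem_nhds haV)
    have h1 := loj_near g hgA.continuousAt hg0 m C hm h ε hε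
    have ht : Tendsto (fun x => x - a) (𝓝 a) (𝓝 0) := by
      have : Continuous (fun x : EuclideanSpace ℝ (Fin d) => x - a) := by fun_prop
      exact this.tendsto' _ _ (by simp)
    refine ⟨m, C, hm, hC, ?_⟩
    filter_upwards [ht.eventually h1] with x ⟨y, hy, hxy, hyn⟩
    have hmem : a + y ∈ {y ∈ V | f y = 0} := ⟨hball (by simpa [dist_eq_norm] using hyn), hy⟩
    have h2 : min (infDist x {y ∈ V | f y = 0}) 1 ≤ ‖x - a - y‖ := by
      refine (min_le_left _ _).trans ((infDist_le_dist_of_mem hmem).trans_eq ?_)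
      rw [dist_eq_norm, sub_sub]
    have h3 : g (x - a) = f x := by simp [hg]
    rw [h3] at hxy
    exact (pow_le_pow_left₀ (le_min infDist_nonneg zero_le_one) h2 m).trans hxy
  · have hpos : 0 < |f a| := abs_pos.2 h0
    refine ⟨1, 2 / |f a|, le_rfl, by positivity, ?_⟩
    have h1 : ∀ᶠ x in 𝓝 a, |f a| / 2 < |f x| :=
      hf.continuousAt.abs.eventually_const_lt (by linarith)
    filter_upwards [h1] with x hx
    rw [pow_one]
    refine (min_le_right _ _).trans ?_
    rw [div_mul_eq_mul_div, le_div_iff₀ hpos]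
    linarith

/-- Łojasiewicz inequality, compact form: if `f` is real analytic on an open set
`V ⊆ ℝ^d` with zero set `Z_f`, then for every compact `K ⊆ V` there are `c > 0`
and `m > 0` with `|f x| ≥ c * dist(x, Z_f)^m` for all `x ∈ K`. -/
theorem stmt4 {d : ℕ} {V : Set (EuclideanSpace ℝ (Fin d))} (hV : IsOpen V)
    (f : EuclideanSpace ℝ (Fin d) → ℝ) (hf : AnalyticOn ℝ f V)
    (K : Set (EuclideanSpace ℝ (Fin d))) (hK : IsCompact K) (hKV : K ⊆ V) :
    ∃ c m : ℝ, 0 < c ∧ 0 < m ∧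
      ∀ x ∈ K, c * (infDist x {y ∈ V | f y = 0}) ^ m ≤ |f x| := by
  have hf' : AnalyticOnNhd ℝ f V := hV.analyticOn_iff_analyticOnNhd.1 hf
  set Z : Set (EuclideanSpace ℝ (Fin d)) := {y ∈ V | f y = 0} with hZ
  have hu0 : ∀ x, 0 ≤ min (infDist x Z) 1 := fun x => le_min infDist_nonneg zero_le_one
  have hu1 : ∀ x, min (infDist x Z) 1 ≤ 1 := fun x => min_le_right _ _
  have key : ∃ (m : ℕ) (C : ℝ), 1 ≤ m ∧ 0 < C ∧ ∀ x ∈ K,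
      (min (infDist x Z) 1) ^ m ≤ C * |f x| := by
    refine hK.induction_on (p := fun S => ∃ (m : ℕ) (C : ℝ), 1 ≤ m ∧ 0 < C ∧ ∀ x ∈ S,
      (min (infDist x Z) 1) ^ m ≤ C * |f x|) ?_ ?_ ?_ ?_
    · exact ⟨1, 1, le_rfl, one_pos, by simp⟩
    · rintro s t hst ⟨m, C, hm, hC, h⟩
      exact ⟨m, C, hm, hC, fun x hx => h x (hst hx)⟩
    · rintro s t ⟨m, C, hm, hC, h⟩ ⟨m', C', hm', hC', h'⟩
      refine ⟨m + m', C + C', by omega, by positivity, ?_⟩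
      have hmono : ∀ x, (min (infDist x Z) 1) ^ (m + m') ≤ (min (infDist x Z) 1) ^ m := fun x =>
        pow_le_pow_of_le_one (hu0 x) (hu1 x) (by omega)
      have hmono' : ∀ x, (min (infDist x Z) 1) ^ (m + m') ≤ (min (infDist x Z) 1) ^ m' := fun x =>
        pow_le_pow_of_le_one (hu0 x) (hu1 x) (by omega)
      rintro x (hx | hx)
      · refine (hmono x).trans ((h x hx).trans ?_)
        gcongr; linarith
      · refine (hmono' x).trans ((h' x hx).trans ?_)
        gcongr; linarith
    · intro a haK
      obtain ⟨m, C, hm, hC, h⟩ := loj_at_point hV f a (hKV haK) (hf' a (hKV haK))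
      exact ⟨_, mem_nhdsWithin_of_mem_nhds h, m, C, hm, hC, fun x hx => hx⟩
  obtain ⟨m, C, hm, hC, h⟩ := key
  obtain ⟨D, hD⟩ := hK.exists_bound_of_continuousOn (continuous_infDist_pt Z).continuousOn
  set M : ℝ := max D 1 with hM
  have hM1 : 1 ≤ M := le_max_right _ _
  refine ⟨1 / (M ^ m * C), m, by positivity, by exact_mod_cast hm, fun x hx => ?_⟩
  have h1 : infDist x Z ≤ M * min (infDist x Z) 1 := by
    rcases le_total (infDist x Z) 1 with h2 | h2
    · rw [min_eq_left h2]
      exact le_mul_of_one_le_left infDist_nonneg hM1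
    · rw [min_eq_right h2, mul_one]
      exact (le_abs_self _).trans ((hD x hx).trans (le_max_left _ _))
  rw [Real.rpow_natCast, one_div, inv_mul_le_iff₀ (by positivity)]
  calc infDist x Z ^ m ≤ (M * min (infDist x Z) 1) ^ m := pow_le_pow_left₀ infDist_nonneg h1 m
    _ = M ^ m * (min (infDist x Z) 1) ^ m := mul_pow _ _ _
    _ ≤ M ^ m * (C * |f x|) := by gcongr; exact h x hx
    _ = _ := by ring
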